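/- Let N = 3 and suppose κ > 4.8·D(Ω). Then for Lebesgue-almost every initial phase vector Θ⁰ ∈ ℝ³, the Kuramoto solution θ with θ(0) = Θ⁰ satisfies: all pairwise phase differences θ_i(t) − θ_j(t) converge to finite limits as t → ∞, and there exist integers m₁, m₂, m₃ and a time T ≥ 0 such that for all t ≥ T, max_{i,j} |(θ_i(t)+2π·m_i) − (θ_j(t)+2π·m_j)| ≤ π/2 (i.e., the configuration is eventually confined, modulo 2π, to a quarter-circle). -/

import Mathlib

/-- A Kuramoto solution on `[0,∞)` (modeled as a function on ℝ whose ODE holds on `Set.Ici 0`). -/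
def IsKuramotoOn {N : ℕ} (κ : ℝ) (ν : Fin N → ℝ) (θ : ℝ → Fin N → ℝ) : Prop :=
  ∀ (i : Fin N), ∀ t ∈ Set.Ici (0 : ℝ), HasDerivWithinAt (fun s => θ s i)
    (ν i + κ / N * ∑ j, Real.sin (θ t j - θ t i)) (Set.Ici 0) t

/-- Diameter of natural frequencies `D(Ω) = max_{i,j} |νᵢ − νⱼ|`. -/
noncomputable def freqDiam {N : ℕ} (ν : Fin N → ℝ) : ℝ :=
  sSup {d : ℝ | ∃ i : Fin N, ∃ j : Fin N, d = |ν i - ν j|}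

open Set Filter Topology MeasureTheory

theorem abs_sub_le_freqDiam {N : ℕ} (ν : Fin N → ℝ) (i j : Fin N) :
    |ν i - ν j| ≤ freqDiam ν := by
  refine le_csSup ?_ ⟨i, j, rfl⟩
  refine ((Set.finite_range fun p : Fin N × Fin N => |ν p.1 - ν p.2|).subset ?_).bddAbove
  rintro d ⟨i, j, rfl⟩
  exact ⟨(i, j), rfl⟩

/-- The sum of the cosines of the three phase differences. -/
noncomputable def cosSum (x : Fin 3 → ℝ) : ℝ :=
  Real.cos (x 0 - x 1) + Real.cos (x 1 - x 2) + Real.cos (x 2 - x 0)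

/-- The squared gradient of `cosSum` is controlled from below by its value. -/
theorem cosSum_gradient_sq_ge (a b c : ℝ) (h : a + b + c = 0) :
    3 / 2 * (3 - (Real.cos a + Real.cos b + Real.cos c)) *
        (1 + (Real.cos a + Real.cos b + Real.cos c)) ≤
      (Real.sin c - Real.sin a) ^ 2 + (Real.sin a - Real.sin b) ^ 2 +
        (Real.sin b - Real.sin c) ^ 2 := by
  obtain rfl : c = -(a + b) := by linarith
  have hA := Real.cos_sq_add_sin_sq a
  have hB := Real.cos_sq_add_sin_sq b
  have hC := Real.cos_sq_add_sin_sq (-(a + b))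
  have h1 := Real.cos_le_one a
  have h2 := Real.cos_le_one b
  have h3 := Real.cos_le_one (-(a + b))
  have eC : Real.cos (-(a + b)) = Real.cos a * Real.cos b - Real.sin a * Real.sin b := by
    rw [Real.cos_neg, Real.cos_add]
  have eS : Real.sin (-(a + b)) = -(Real.sin a * Real.cos b + Real.cos a * Real.sin b) := by
    rw [Real.sin_neg, Real.sin_add]
  set X := Real.cos a
  set Y := Real.cos b
  set Z := Real.cos (-(a + b))
  set p := Real.sin a
  set q := Real.sin b
  set r := Real.sin (-(a + b))
  have k1 : p * q = X * Y - Z := by linarith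
  have k2 : q * r = Y * Z - X := by
    rw [eC, eS]; linear_combination (-X) * hB
  have k3 : r * p = Z * X - Y := by
    rw [eC, eS]; linear_combination (-Y) * hA
  have k4 : X ^ 2 + Y ^ 2 + Z ^ 2 - 2 * X * Y * Z = 1 := by
    have : (X * Y - Z) ^ 2 = (1 - X ^ 2) * (1 - Y ^ 2) := by
      rw [← k1]; linear_combination (p ^ 2) * hB + (1 - Y ^ 2) * hA
    linear_combination this
  have k5 : 0 ≤ (1 - X) * (1 - Y) * (1 - Z) :=
    mul_nonneg (mul_nonneg (by linarith) (by linarith)) (by linarith)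
  have k6 : (r - p) ^ 2 + (p - q) ^ 2 + (q - r) ^ 2 =
      2 * (3 - (X ^ 2 + Y ^ 2 + Z ^ 2) - (X * Y + Y * Z + Z * X) + (X + Y + Z)) := by
    linear_combination 2 * hA + 2 * hB + 2 * hC - 2 * k1 - 2 * k2 - 2 * k3
  rw [k6]
  nlinarith

/-- A function that increases at a positive rate while its values lie in `[a, b]` is eventually at
least `b`. -/
theorem eventually_ge_of_deriv_ge {g g' : ℝ → ℝ} {a b c t₀ : ℝ}
    (hg : ∀ t ≥ t₀, HasDerivWithinAt g (g' t) (Ici t₀) t) (ha : a ≤ g t₀) (hab : a ≤ b)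
    (hc : 0 < c) (H : ∀ t ≥ t₀, a ≤ g t → g t ≤ b → c ≤ g' t) :
    ∃ T ≥ t₀, ∀ t ≥ T, b ≤ g t := by
  have cont : ContinuousOn g (Ici t₀) := fun t ht => (hg t ht).continuousWithinAt
  have der : ∀ t ≥ t₀, HasDerivWithinAt (fun s => -g s) (-g' t) (Ici t) t := fun t ht =>
    ((hg t ht).mono (Ici_subset_Ici.2 ht)).neg
  have hT : t₀ ≤ t₀ + 2 * (b - a) / c := by
    have : 0 ≤ 2 * (b - a) / c := div_nonneg (by linarith) hc.le
    linarith
  have reach : b ≤ g (t₀ + 2 * (b - a) / c) := by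
    have key := image_le_of_deriv_right_lt_deriv_boundary (f := fun s => -g s)
      (f' := fun s => -g' s) (a := t₀) (b := t₀ + 2 * (b - a) / c)
      (B := fun t => -(a + c / 2 * (t - t₀))) (B' := fun _ => -(c / 2))
      (cont.neg.mono Icc_subset_Ici_self) (fun t ht => der t ht.1) (by simpa using ha)
      (fun t => ((((hasDerivAt_id t).sub_const t₀).const_mul (c / 2)).const_add a).neg.congr_deriv
        (by simp))
      (fun t ht heq => by
        have e : g t = a + c / 2 * (t - t₀) := neg_injective heq
        have l1 : 0 ≤ c / 2 * (t - t₀) := mul_nonneg (by linarith) (by linarith [ht.1])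
        have l2 : c / 2 * (t - t₀) ≤ b - a := by
          have : c / 2 * (t - t₀) ≤ c / 2 * (2 * (b - a) / c) :=
            mul_le_mul_of_nonneg_left (by linarith [ht.2]) (by linarith)
          have e2 : c / 2 * (2 * (b - a) / c) = b - a := by field_simp
          linarith
        have := H t ht.1 (by linarith) (by linarith)
        change -g' t < -(c / 2)
        linarith)
      (right_mem_Icc.2 hT)
    have e2 : c / 2 * (2 * (b - a) / c) = b - a := by field_simp
    simp only [add_sub_cancel_left, e2] at key
    linarith
  refine ⟨_, hT, fun t ht => ?_⟩
  have key := image_le_of_deriv_right_lt_deriv_boundary (f := fun s => -g s)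
      (f' := fun s => -g' s) (a := t₀ + 2 * (b - a) / c) (b := t)
      (B := fun _ => -b) (B' := fun _ => 0)
      (cont.neg.mono (Icc_subset_Ici_self.trans (Ici_subset_Ici.2 hT)))
      (fun s hs => der s (hT.trans hs.1)) (by simpa using reach)
      (fun s => hasDerivAt_const s _)
      (fun s hs heq => by
        have e : g s = b := by simpa using heq
        have := H s (hT.trans hs.1) (by linarith) (by linarith)
        change -g' s < 0
        linarith)
      (right_mem_Icc.2 ht)
  simpa using key

theorem abs_lt_pi_div_two_of_cos_pos {x : ℝ} (hx : |x| ≤ Real.pi) (h : 0 < Real.cos x) :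
    |x| < Real.pi / 2 := by
  by_contra! hlt
  have := Real.cos_nonpos_of_pi_div_two_le_of_le hlt (by linarith [Real.pi_pos])
  rw [Real.cos_abs] at this
  linarith

theorem exists_int_abs_add_lt_pi_div_two {x : ℝ} (h : 0 < Real.cos x) :
    ∃ k : ℤ, |x + 2 * Real.pi * k| < Real.pi / 2 := by
  have hp := Real.pi_pos
  refine ⟨-round (x / (2 * Real.pi)), abs_lt_pi_div_two_of_cos_pos ?_ ?_⟩
  · have h1 := abs_sub_round (x / (2 * Real.pi))
    have e : x + 2 * Real.pi * ((-round (x / (2 * Real.pi)) : ℤ) : ℝ) =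
        2 * Real.pi * (x / (2 * Real.pi) - round (x / (2 * Real.pi))) := by
      push_cast; field_simp; ring
    rw [e, abs_mul, abs_of_pos (by positivity)]
    nlinarith
  · have e : x + 2 * Real.pi * ((-round (x / (2 * Real.pi)) : ℤ) : ℝ) =
        x + ((-round (x / (2 * Real.pi)) : ℤ) : ℝ) * (2 * Real.pi) := by ring
    rwa [e, Real.cos_add_int_mul_two_pi]

theorem abs_lt_pi_div_two_of_continuousOn {g : ℝ → ℝ} {T : ℝ} (hg : ContinuousOn g (Ici T))
    (hT : |g T| < Real.pi / 2) (hcos : ∀ t ≥ T, 0 < Real.cos (g t)) :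
    ∀ t ≥ T, |g t| < Real.pi / 2 := by
  intro t ht
  by_contra! hlt
  obtain ⟨s, hs, hs'⟩ := intermediate_value_Icc ht
    ((hg.mono Icc_subset_Ici_self).abs) ⟨hT.le, hlt⟩
  have h1 := hcos s hs.1
  rw [← Real.cos_abs, show |g s| = Real.pi / 2 from hs', Real.cos_pi_div_two] at h1
  exact lt_irrefl _ h1

/-- A bounded function whose derivative decays exponentially converges. -/
theorem exists_tendsto_of_abs_deriv_le_exp {g g' : ℝ → ℝ} {T C l B : ℝ} (hl : 0 < l)
    (hg : ∀ t > T, HasDerivAt g (g' t) t) (hbd : ∀ t > T, |g' t| ≤ C * Real.exp (-(l * t)))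
    (hB : ∀ t > T, B ≤ g t) : ∃ L, Tendsto g atTop (𝓝 L) := by
  have hE : Tendsto (fun t => C / l * Real.exp (-(l * t))) atTop (𝓝 (C / l * 0)) :=
    (Real.tendsto_exp_neg_atTop_nhds_zero.comp (tendsto_id.const_mul_atTop hl)).const_mul _
  have hC : 0 ≤ C := by
    have := (abs_nonneg _).trans (hbd (T + 1) (by linarith))
    exact nonneg_of_mul_nonneg_left this (Real.exp_pos _)
  have hder : ∀ t > T, HasDerivAt (fun t => g t + C / l * Real.exp (-(l * t)))
      (g' t - C * Real.exp (-(l * t))) t := by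
    intro t ht
    have h1 : HasDerivAt (fun t => -(l * t)) (-l) t :=
      ((hasDerivAt_id t).const_mul l).neg.congr_deriv (by simp)
    exact ((hg t ht).add (h1.exp.const_mul (C / l))).congr_deriv (by field_simp; ring)
  have hanti : AntitoneOn (fun t => g t + C / l * Real.exp (-(l * t))) (Ici (T + 1)) := by
    refine antitoneOn_of_deriv_nonpos (convex_Ici _)
      (fun t ht => (hder t ?_).continuousAt.continuousWithinAt)
      (fun t ht => ((hder t ?_).differentiableAt).differentiableWithinAt) (fun t ht => ?_)
    · have : T + 1 ≤ t := ht
      linarith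
    · rw [interior_Ici] at ht
      have : T + 1 < t := ht
      linarith
    · rw [interior_Ici] at ht
      have h2 : T < t := by
        have : T + 1 < t := ht
        linarith
      rw [(hder t h2).deriv]
      linarith [(abs_le.1 (hbd t h2)).2]
  have hG : Antitone (fun t => g (max t (T + 1)) + C / l * Real.exp (-(l * max t (T + 1)))) :=
    fun s t hst => hanti (mem_Ici.2 (le_max_right _ _)) (mem_Ici.2 (le_max_right _ _)) (max_le_max_right _ hst)
  have hlim := tendsto_atTop_ciInf hG ⟨B, by
    rintro _ ⟨t, rfl⟩
    have h1 := hB (max t (T + 1)) (by linarith [le_max_right t (T + 1)])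
    have h2 : 0 ≤ C / l * Real.exp (-(l * max t (T + 1))) := by positivity
    change B ≤ g (max t (T + 1)) + C / l * Real.exp (-(l * max t (T + 1)))
    linarith⟩
  refine ⟨_, (hlim.sub hE).congr' ?_⟩
  filter_upwards [eventually_ge_atTop (T + 1)] with t ht
  simp [max_eq_left ht]

/-- The Kuramoto vector field for three oscillators. -/
noncomputable def kuramotoField (κ : ℝ) (ν : Fin 3 → ℝ) (x : Fin 3 → ℝ) : Fin 3 → ℝ :=
  fun i => ν i + κ / 3 * ∑ j, Real.sin (x j - x i)

theorem IsKuramotoOn.hasDerivWithinAt {κ : ℝ} {ν : Fin 3 → ℝ} {θ : ℝ → Fin 3 → ℝ}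
    (h : IsKuramotoOn κ ν θ) (i : Fin 3) {t : ℝ} (ht : 0 ≤ t) :
    HasDerivWithinAt (fun s => θ s i) (kuramotoField κ ν (θ t) i) (Ici 0) t := by
  have := h i t ht
  exact_mod_cast this

theorem IsKuramotoOn.hasDerivAt {κ : ℝ} {ν : Fin 3 → ℝ} {θ : ℝ → Fin 3 → ℝ}
    (h : IsKuramotoOn κ ν θ) (i : Fin 3) {t : ℝ} (ht : 0 < t) :
    HasDerivAt (fun s => θ s i) (kuramotoField κ ν (θ t) i) t :=
  (h.hasDerivWithinAt i ht.le).hasDerivAt (Ici_mem_nhds ht)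

/-- The derivative of `cosSum` at `x` in the direction `v`. -/
noncomputable def cosSumDeriv (x v : Fin 3 → ℝ) : ℝ :=
  -Real.sin (x 0 - x 1) * (v 0 - v 1) + -Real.sin (x 1 - x 2) * (v 1 - v 2) +
    -Real.sin (x 2 - x 0) * (v 2 - v 0)

theorem IsKuramotoOn.hasDerivWithinAt_cosSum {κ : ℝ} {ν : Fin 3 → ℝ} {θ : ℝ → Fin 3 → ℝ}
    (h : IsKuramotoOn κ ν θ) {t : ℝ} (ht : 0 ≤ t) :
    HasDerivWithinAt (fun s => cosSum (θ s))
      (cosSumDeriv (θ t) (kuramotoField κ ν (θ t))) (Ici 0) t := by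
  have h0 := h.hasDerivWithinAt 0 ht
  have h1 := h.hasDerivWithinAt 1 ht
  have h2 := h.hasDerivWithinAt 2 ht
  exact ((h0.sub h1).cos.add (h1.sub h2).cos).add (h2.sub h0).cos

theorem cosSumDeriv_kuramotoField_ge {κ : ℝ} {ν : Fin 3 → ℝ}
    (hν : ∀ i j, 4.8 * |ν i - ν j| < κ) {x : Fin 3 → ℝ}
    (h1 : -(1 / 10) ≤ cosSum x) (h2 : cosSum x ≤ 5 / 2) :
    κ / 5 ≤ cosSumDeriv x (kuramotoField κ ν x) := by
  have key := cosSum_gradient_sq_ge (x 0 - x 1) (x 1 - x 2) (x 2 - x 0) (by ring)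
  have e10 : Real.sin (x 1 - x 0) = -Real.sin (x 0 - x 1) := by rw [← Real.sin_neg, neg_sub]
  have e21 : Real.sin (x 2 - x 1) = -Real.sin (x 1 - x 2) := by rw [← Real.sin_neg, neg_sub]
  have e02 : Real.sin (x 0 - x 2) = -Real.sin (x 2 - x 0) := by rw [← Real.sin_neg, neg_sub]
  have hκ : 0 < κ := by simpa using hν 0 0
  simp only [cosSum] at h1 h2
  simp only [cosSumDeriv, kuramotoField, Fin.sum_univ_three, sub_self, Real.sin_zero, e10, e21, e02]
  set S := Real.cos (x 0 - x 1) + Real.cos (x 1 - x 2) + Real.cos (x 2 - x 0)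
  set p := Real.sin (x 0 - x 1)
  set q := Real.sin (x 1 - x 2)
  set r := Real.sin (x 2 - x 0)
  have hQ : 21 / 8 ≤ (r - p) ^ 2 + (p - q) ^ 2 + (q - r) ^ 2 := by nlinarith
  have n0 := hν 0 2
  have n1 := hν 1 2
  have b0 : -(5 / 24 * κ * ((r - p) ^ 2 + 1 / 4)) ≤ (ν 0 - ν 2) * (r - p) := by
    have a1 : |ν 0 - ν 2| ≤ 5 / 24 * κ := by norm_num at n0 n1 ⊢; linarith
    have a2 : |r - p| ≤ (r - p) ^ 2 + 1 / 4 := by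
      rw [← sq_abs]; nlinarith [sq_nonneg (|r - p| - 1 / 2)]
    have a3 := mul_le_mul a1 a2 (abs_nonneg _) (by positivity)
    rw [← abs_mul] at a3
    exact (abs_le.1 a3).1
  have b1 : -(5 / 24 * κ * ((p - q) ^ 2 + 1 / 4)) ≤ (ν 1 - ν 2) * (p - q) := by
    have a1 : |ν 1 - ν 2| ≤ 5 / 24 * κ := by norm_num at n0 n1 ⊢; linarith
    have a2 : |p - q| ≤ (p - q) ^ 2 + 1 / 4 := by
      rw [← sq_abs]; nlinarith [sq_nonneg (|p - q| - 1 / 2)]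
    have a3 := mul_le_mul a1 a2 (abs_nonneg _) (by positivity)
    rw [← abs_mul] at a3
    exact (abs_le.1 a3).1
  have e : -p * (ν 0 + κ / 3 * (0 + -p + r) - (ν 1 + κ / 3 * (p + 0 + -q))) +
      -q * (ν 1 + κ / 3 * (p + 0 + -q) - (ν 2 + κ / 3 * (-r + q + 0))) +
      -r * (ν 2 + κ / 3 * (-r + q + 0) - (ν 0 + κ / 3 * (0 + -p + r))) =
      (ν 0 - ν 2) * (r - p) + (ν 1 - ν 2) * (p - q) +
        κ / 3 * ((r - p) ^ 2 + (p - q) ^ 2 + (q - r) ^ 2) := by ring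
  rw [e]
  have c1 : 0 ≤ κ * (q - r) ^ 2 := by positivity
  have c2 := mul_le_mul_of_nonneg_left hQ hκ.le
  linarith

/-- The sum of squared differences of the velocities. -/
noncomputable def sqDiff (v : Fin 3 → ℝ) : ℝ :=
  (v 0 - v 1) ^ 2 + (v 1 - v 2) ^ 2 + (v 2 - v 0) ^ 2

theorem abs_sub_le_sqrt_sqDiff (v : Fin 3 → ℝ) (i j : Fin 3) : |v i - v j| ≤ √(sqDiff v) := by
  refine Real.abs_le_sqrt ?_
  unfold sqDiff
  fin_cases i <;> fin_cases j <;> simp <;>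
    nlinarith [sq_nonneg (v 0 - v 1), sq_nonneg (v 1 - v 2), sq_nonneg (v 2 - v 0)]

/-- Once all phase differences have cosine at least `1/2`, the frequency differences decay
exponentially. -/
theorem IsKuramotoOn.sqDiff_le {κ : ℝ} {ν : Fin 3 → ℝ} {θ : ℝ → Fin 3 → ℝ}
    (h : IsKuramotoOn κ ν θ) (hκ : 0 < κ) {T : ℝ} (hT : 0 < T)
    (hcos : ∀ t ≥ T, 5 / 2 ≤ cosSum (θ t)) :
    ∃ C, ∀ t ≥ T, sqDiff (kuramotoField κ ν (θ t)) ≤ C * Real.exp (-(κ * t)) := by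
  let a : Fin 3 → Fin 3 → ℝ → ℝ := fun i j t => Real.cos (θ t j - θ t i)
  let v : ℝ → Fin 3 → ℝ := fun t => kuramotoField κ ν (θ t)
  have hv : ∀ i, ∀ t > 0, HasDerivAt (fun s => v s i)
      (κ / 3 * ∑ j, a i j t * (v t j - v t i)) t := by
    intro i t ht
    have : ∀ j, HasDerivAt (fun s => Real.sin (θ s j - θ s i)) (a i j t * (v t j - v t i)) t :=
      fun j => ((h.hasDerivAt j ht).sub (h.hasDerivAt i ht)).sin
    exact ((HasDerivAt.fun_sum (u := Finset.univ) fun j _ => this j).const_mul (κ / 3)).const_add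
      (ν i)
  have hs : ∀ i j t, a i j t = a j i t := fun i j t => by
    simp only [a]; rw [← Real.cos_neg, neg_sub]
  have hP : ∀ t > 0, HasDerivAt (fun s => sqDiff (v s)) (-(2 * κ) *
      (a 0 1 t * (v t 0 - v t 1) ^ 2 + a 1 2 t * (v t 1 - v t 2) ^ 2 +
        a 2 0 t * (v t 2 - v t 0) ^ 2)) t := by
    intro t ht
    have h0 := hv 0 t ht
    have h1 := hv 1 t ht
    have h2 := hv 2 t ht
    refine ((((h0.sub h1).pow 2).add ((h1.sub h2).pow 2)).add ((h2.sub h0).pow 2)).congr_deriv ?_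
    simp only [Fin.sum_univ_three, hs 1 0 t, hs 2 1 t, hs 0 2 t, Pi.sub_apply]
    ring
  have hE : ∀ t > 0, HasDerivAt (fun s => sqDiff (v s) * Real.exp (κ * s)) (-(2 * κ) *
      (a 0 1 t * (v t 0 - v t 1) ^ 2 + a 1 2 t * (v t 1 - v t 2) ^ 2 +
        a 2 0 t * (v t 2 - v t 0) ^ 2) * Real.exp (κ * t) +
        sqDiff (v t) * (Real.exp (κ * t) * κ)) t := by
    intro t ht
    have h1 : HasDerivAt (fun s => κ * s) κ t :=
      ((hasDerivAt_id t).const_mul κ).congr_deriv (by simp)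
    exact (hP t ht).mul h1.exp
  have hanti : AntitoneOn (fun s => sqDiff (v s) * Real.exp (κ * s)) (Ici T) := by
    refine antitoneOn_of_deriv_nonpos (convex_Ici _)
      (fun t ht => (hE t (hT.trans_le ht)).continuousAt.continuousWithinAt)
      (fun t ht => ?_) (fun t ht => ?_)
    · rw [interior_Ici] at ht
      exact (hE t (hT.trans ht)).differentiableAt.differentiableWithinAt
    · rw [interior_Ici] at ht
      rw [(hE t (hT.trans ht)).deriv]
      have hc := hcos t (le_of_lt ht)
      simp only [cosSum] at hc
      have u0 := Real.cos_le_one (θ t 0 - θ t 1)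
      have u1 := Real.cos_le_one (θ t 1 - θ t 2)
      have u2 := Real.cos_le_one (θ t 2 - θ t 0)
      have l0 : 1 / 2 ≤ a 0 1 t := by rw [hs]; simp only [a]; linarith
      have l1 : 1 / 2 ≤ a 1 2 t := by rw [hs]; simp only [a]; linarith
      have l2 : 1 / 2 ≤ a 2 0 t := by rw [hs]; simp only [a]; linarith
      have m : sqDiff (v t) / 2 ≤ a 0 1 t * (v t 0 - v t 1) ^ 2 + a 1 2 t * (v t 1 - v t 2) ^ 2 +
          a 2 0 t * (v t 2 - v t 0) ^ 2 := by
        simp only [sqDiff]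
        nlinarith [mul_nonneg (sub_nonneg.2 l0) (sq_nonneg (v t 0 - v t 1)),
          mul_nonneg (sub_nonneg.2 l1) (sq_nonneg (v t 1 - v t 2)),
          mul_nonneg (sub_nonneg.2 l2) (sq_nonneg (v t 2 - v t 0))]
      have := mul_le_mul_of_nonneg_left m (mul_pos hκ (Real.exp_pos (κ * t))).le
      linarith
  refine ⟨sqDiff (v T) * Real.exp (κ * T), fun t ht => ?_⟩
  rw [Real.exp_neg, ← div_eq_mul_inv, le_div_iff₀ (Real.exp_pos _)]
  exact hanti self_mem_Ici ht ht

theorem IsKuramotoOn.locked {κ : ℝ} {ν : Fin 3 → ℝ} {θ : ℝ → Fin 3 → ℝ}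
    (h : IsKuramotoOn κ ν θ) (hν : ∀ i j, 4.8 * |ν i - ν j| < κ) {t₀ : ℝ} (ht₀ : 0 ≤ t₀)
    (hS : -(1 / 10) ≤ cosSum (θ t₀)) :
    (∀ i j : Fin 3, ∃ L : ℝ, Tendsto (fun t => θ t i - θ t j) atTop (𝓝 L)) ∧
      ∃ (m : Fin 3 → ℤ) (T : ℝ), 0 ≤ T ∧ ∀ t ≥ T, ∀ i j : Fin 3,
        |(θ t i + 2 * Real.pi * m i) - (θ t j + 2 * Real.pi * m j)| ≤ Real.pi / 2 := by
  have hκ : 0 < κ := by simpa using hν 0 0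
  obtain ⟨T₁, hT₁, hcos₁⟩ := eventually_ge_of_deriv_ge (a := -(1 / 10)) (b := 5 / 2) (c := κ / 5)
    (fun t ht => (h.hasDerivWithinAt_cosSum (ht₀.trans ht)).mono (Ici_subset_Ici.2 ht₀)) hS
    (by norm_num) (by positivity) (fun t _ h1 h2 => cosSumDeriv_kuramotoField_ge hν h1 h2)
  obtain ⟨T, hT, hcos⟩ : ∃ T > 0, ∀ t ≥ T, 5 / 2 ≤ cosSum (θ t) :=
    ⟨T₁ + 1, by linarith, fun t ht => hcos₁ t (by linarith)⟩
  have c01 : ∀ t ≥ T, 0 < Real.cos (θ t 0 - θ t 1) := fun t ht => by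
    have := hcos t ht
    simp only [cosSum] at this
    linarith [Real.cos_le_one (θ t 1 - θ t 2), Real.cos_le_one (θ t 2 - θ t 0)]
  have c12 : ∀ t ≥ T, 0 < Real.cos (θ t 1 - θ t 2) := fun t ht => by
    have := hcos t ht
    simp only [cosSum] at this
    linarith [Real.cos_le_one (θ t 0 - θ t 1), Real.cos_le_one (θ t 2 - θ t 0)]
  have c20 : ∀ t ≥ T, 0 < Real.cos (θ t 2 - θ t 0) := fun t ht => by
    have := hcos t ht
    simp only [cosSum] at this
    linarith [Real.cos_le_one (θ t 1 - θ t 2), Real.cos_le_one (θ t 0 - θ t 1)]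
  have cont : ∀ i, ContinuousOn (fun t => θ t i) (Ici T) := fun i t ht =>
    (h.hasDerivAt i (hT.trans_le ht)).continuousAt.continuousWithinAt
  have shift : ∀ (x : ℝ) (k : ℤ), Real.cos (x + 2 * Real.pi * k) = Real.cos x := fun x k => by
    rw [mul_comm, Real.cos_add_int_mul_two_pi]
  obtain ⟨k, hk⟩ := exists_int_abs_add_lt_pi_div_two (c01 T le_rfl)
  obtain ⟨l, hl⟩ := exists_int_abs_add_lt_pi_div_two (c12 T le_rfl)
  have b01 := abs_lt_pi_div_two_of_continuousOn
    (g := fun t => θ t 0 - θ t 1 + 2 * Real.pi * k) (((cont 0).sub (cont 1)).add continuousOn_const)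
    hk (fun t ht => by rw [shift]; exact c01 t ht)
  have b12 := abs_lt_pi_div_two_of_continuousOn
    (g := fun t => θ t 1 - θ t 2 + 2 * Real.pi * l) (((cont 1).sub (cont 2)).add continuousOn_const)
    hl (fun t ht => by rw [shift]; exact c12 t ht)
  have b20 : ∀ t ≥ T, |θ t 2 - θ t 0 + 2 * Real.pi * (-k - l : ℤ)| < Real.pi / 2 := by
    intro t ht
    refine abs_lt_pi_div_two_of_cos_pos ?_ (by rw [shift]; exact c20 t ht)
    have e1 := abs_lt.1 (b01 t ht)
    have e2 := abs_lt.1 (b12 t ht)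
    push_cast
    rw [abs_le]
    constructor <;> linarith [e1.1, e1.2, e2.1, e2.2]
  have conf : ∀ t ≥ T, ∀ i j : Fin 3, |(θ t i + 2 * Real.pi * (![k, 0, -l] i : ℤ)) -
      (θ t j + 2 * Real.pi * (![k, 0, -l] j : ℤ))| ≤ Real.pi / 2 := by
    intro t ht i j
    have e1 := abs_lt.1 (b01 t ht)
    have e2 := abs_lt.1 (b12 t ht)
    have e3 := abs_lt.1 (b20 t ht)
    push_cast at e3
    have hp := Real.pi_pos
    rw [abs_le]
    fin_cases i <;> fin_cases j <;> simp <;> (try constructor) <;> linarith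
  refine ⟨fun i j => ?_, ![k, 0, -l], T, hT.le, conf⟩
  obtain ⟨C, hC⟩ := h.sqDiff_le hκ hT hcos
  refine exists_tendsto_of_abs_deriv_le_exp (T := T) (C := √C) (l := κ / 2)
    (B := -(Real.pi / 2) - 2 * Real.pi * (![k, 0, -l] i : ℤ) + 2 * Real.pi * (![k, 0, -l] j : ℤ))
    (half_pos hκ)
    (fun t ht => (h.hasDerivAt i (hT.trans ht)).sub (h.hasDerivAt j (hT.trans ht)))
    (fun t ht => ?_) (fun t ht => ?_)
  · refine (abs_sub_le_sqrt_sqDiff _ i j).trans ?_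
    have e : √C * Real.exp (-(κ / 2 * t)) = √(C * Real.exp (-(κ * t))) := by
      rw [Real.sqrt_mul' _ (Real.exp_pos _).le, ← Real.exp_half]
      congr 2
      ring
    rw [e]
    exact Real.sqrt_le_sqrt (hC t (le_of_lt ht))
  · have := (abs_le.1 (conf t (le_of_lt ht) i j)).1
    linarith

/-- A map with bounded displacement that expands volume on a forward-invariant set forces this set
to be null: its volume in balls would otherwise grow exponentially with the radius. -/
theorem volume_eq_zero_of_expanding {A : Set (Fin 3 → ℝ)} {f : (Fin 3 → ℝ) → Fin 3 → ℝ} {c M : ℝ}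
    (hc : 1 < c) (hM : 0 ≤ M) (hf : ∀ x, dist (f x) x ≤ M) (hA : MapsTo f A A)
    (hAm : MeasurableSet A)
    (hexp : ∀ B ⊆ A, MeasurableSet B → ENNReal.ofReal c * volume B ≤ volume (f '' B)) :
    volume A = 0 := by
  have hc0 : 0 < c := by linarith
  set a : ℝ → ENNReal := fun r => volume (A ∩ Metric.closedBall 0 r)
  have step : ∀ r, ENNReal.ofReal c * a r ≤ a (r + M) := fun r => by
    refine (hexp _ inter_subset_left (hAm.inter measurableSet_closedBall)).trans
      (measure_mono ?_)
    rintro _ ⟨x, ⟨hxA, hxr⟩, rfl⟩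
    refine ⟨hA hxA, Metric.mem_closedBall.2 ?_⟩
    linarith [dist_triangle (f x) x 0, hf x, Metric.mem_closedBall.1 hxr]
  have iter : ∀ (r : ℝ) (k : ℕ), ENNReal.ofReal (c ^ k) * a r ≤ a (r + k * M) := by
    intro r k
    induction k with
    | zero => simp
    | succ k ih =>
      calc ENNReal.ofReal (c ^ (k + 1)) * a r
          = ENNReal.ofReal c * (ENNReal.ofReal (c ^ k) * a r) := by
            rw [pow_succ', ENNReal.ofReal_mul hc0.le, mul_assoc]
        _ ≤ ENNReal.ofReal c * a (r + k * M) := by gcongr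
        _ ≤ a (r + k * M + M) := step _
        _ = a (r + (k + 1 : ℕ) * M) := by congr 1; push_cast; ring
  have upper : ∀ r, 0 ≤ r → a r ≤ ENNReal.ofReal ((2 * r) ^ 3) := fun r hr => by
    have := Real.volume_pi_closedBall (0 : Fin 3 → ℝ) hr
    rw [Fintype.card_fin] at this
    exact (measure_mono inter_subset_right).trans this.le
  have zero : ∀ r, 0 ≤ r → a r = 0 := by
    intro r hr
    have hfin : a r ≠ ⊤ := ((upper r hr).trans_lt ENNReal.ofReal_lt_top).ne
    have hbd : ∀ k : ℕ, 1 ≤ k → (a r).toReal ≤ (2 * (r + M)) ^ 3 * ((k : ℝ) ^ 3 / c ^ k) := by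
      intro k hk
      have hk' : (1 : ℝ) ≤ k := by exact_mod_cast hk
      have hrk : 0 ≤ r + k * M := by positivity
      have h1 := (iter r k).trans (upper _ hrk)
      have h2 := ENNReal.toReal_mono ENNReal.ofReal_ne_top h1
      rw [ENNReal.toReal_mul, ENNReal.toReal_ofReal (by positivity),
        ENNReal.toReal_ofReal (by positivity)] at h2
      have h3 : 2 * (r + k * M) ≤ 2 * (r + M) * k := by nlinarith
      have h4 : (2 * (r + k * M)) ^ 3 ≤ (2 * (r + M) * k) ^ 3 :=
        pow_le_pow_left₀ (by positivity) h3 3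
      rw [← mul_div_assoc, le_div_iff₀ (by positivity), ← mul_pow]
      linarith
    have hlim : Tendsto (fun k : ℕ => (2 * (r + M)) ^ 3 * ((k : ℝ) ^ 3 / c ^ k)) atTop (𝓝 0) := by
      simpa using (tendsto_pow_const_div_const_pow_of_one_lt 3 hc).const_mul ((2 * (r + M)) ^ 3)
    have hle : (a r).toReal ≤ 0 := ge_of_tendsto hlim
      ((eventually_ge_atTop 1).mono fun k hk => hbd k hk)
    have := le_antisymm hle ENNReal.toReal_nonneg
    exact (ENNReal.toReal_eq_zero_iff _).1 this |>.resolve_right hfin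
  have hU : A ⊆ ⋃ n : ℕ, A ∩ Metric.closedBall 0 (n : ℝ) := fun x hx => by
    obtain ⟨n, hn⟩ := exists_nat_ge (dist x 0)
    exact mem_iUnion.2 ⟨n, hx, Metric.mem_closedBall.2 hn⟩
  exact measure_mono_null hU (measure_iUnion_null fun n => zero n n.cast_nonneg)

theorem abs_sin_mixed_difference_le (a b c d : ℝ) :
    |Real.sin a - Real.sin b - (Real.sin c - Real.sin d)| ≤
      |a - b - (c - d)| + |c - d| * ((|a - c| + |b - d|) / 2) := by
  have e : Real.sin a - Real.sin b - (Real.sin c - Real.sin d) =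
      2 * (Real.sin ((a - b) / 2) - Real.sin ((c - d) / 2)) * Real.cos ((a + b) / 2) +
        2 * Real.sin ((c - d) / 2) * (Real.cos ((a + b) / 2) - Real.cos ((c + d) / 2)) := by
    rw [Real.sin_sub_sin a b, Real.sin_sub_sin c d]; ring
  rw [e]
  refine (abs_add_le _ _).trans (add_le_add ?_ ?_)
  · rw [abs_mul, abs_mul, abs_two]
    have h1 := Real.abs_sin_sub_sin_le ((a - b) / 2) ((c - d) / 2)
    have h2 := Real.abs_cos_le_one ((a + b) / 2)
    have h3 : |(a - b) / 2 - (c - d) / 2| = |a - b - (c - d)| / 2 := by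
      rw [← sub_div, abs_div, abs_two]
    rw [h3] at h1
    calc 2 * |Real.sin ((a - b) / 2) - Real.sin ((c - d) / 2)| * |Real.cos ((a + b) / 2)|
        ≤ 2 * |Real.sin ((a - b) / 2) - Real.sin ((c - d) / 2)| * 1 := by gcongr
      _ ≤ |a - b - (c - d)| := by linarith
  · rw [abs_mul, abs_mul, abs_two]
    have h1 := Real.abs_sin_le_abs (x := (c - d) / 2)
    have h2 := Real.abs_cos_sub_cos_le ((a + b) / 2) ((c + d) / 2)
    have h3 : |(a + b) / 2 - (c + d) / 2| ≤ (|a - c| + |b - d|) / 2 := by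
      rw [show (a + b) / 2 - (c + d) / 2 = ((a - c) + (b - d)) / 2 by ring, abs_div, abs_two]
      gcongr
      exact abs_add_le _ _
    rw [abs_div, abs_two] at h1
    exact mul_le_mul (by linarith) (h2.trans h3) (abs_nonneg _) (abs_nonneg _)

theorem abs_coord_sub_le (x : Fin 3 → ℝ) (i j : Fin 3) : |x j - x i| ≤ 2 * ‖x‖ := by
  have h1 : |x j| ≤ ‖x‖ := norm_le_pi_norm x j
  have h2 : |x i| ≤ ‖x‖ := norm_le_pi_norm x i
  linarith [abs_sub (x j) (x i)]

theorem abs_coupling_le {κ : ℝ} (hκ : 0 ≤ κ) {s : Fin 3 → ℝ} {C : ℝ} (hs : ∀ j, |s j| ≤ C) :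
    |κ / 3 * ∑ j, s j| ≤ κ * C := by
  rw [abs_mul, abs_of_nonneg (by positivity)]
  have h1 : |∑ j, s j| ≤ ∑ _j : Fin 3, C :=
    (Finset.abs_sum_le_sum_abs _ _).trans (Finset.sum_le_sum fun j _ => hs j)
  simp only [Finset.sum_const, Finset.card_univ, Fintype.card_fin, nsmul_eq_mul] at h1
  push_cast at h1
  nlinarith

theorem norm_kuramotoField_le {κ : ℝ} (hκ : 0 ≤ κ) (ν : Fin 3 → ℝ) (x : Fin 3 → ℝ) : ‖kuramotoField κ ν x‖ ≤ ‖ν‖ + κ := by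
  refine (pi_norm_le_iff_of_nonneg (by positivity)).2 fun i => ?_
  refine (abs_add_le _ _).trans (add_le_add (norm_le_pi_norm ν i) ?_)
  simpa using abs_coupling_le hκ (fun j => Real.abs_sin_le_one (x j - x i))

theorem norm_kuramotoField_sub_le {κ : ℝ} (hκ : 0 ≤ κ) (ν : Fin 3 → ℝ) (x y : Fin 3 → ℝ) :
    ‖kuramotoField κ ν x - kuramotoField κ ν y‖ ≤ 2 * κ * ‖x - y‖ := by
  refine (pi_norm_le_iff_of_nonneg (by positivity)).2 fun i => ?_
  have e : (kuramotoField κ ν x - kuramotoField κ ν y) i =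
      κ / 3 * ∑ j, (Real.sin (x j - x i) - Real.sin (y j - y i)) := by
    simp only [kuramotoField, Pi.sub_apply, Finset.sum_sub_distrib]; ring
  rw [e, Real.norm_eq_abs]
  refine (abs_coupling_le hκ (C := 2 * ‖x - y‖) fun j => ?_).trans_eq (by ring)
  refine (Real.abs_sin_sub_sin_le _ _).trans ?_
  rw [show x j - x i - (y j - y i) = (x - y) j - (x - y) i by simp only [Pi.sub_apply]; ring]
  exact abs_coord_sub_le _ _ _

theorem norm_kuramotoField_mixed_difference_le {κ : ℝ} (hκ : 0 ≤ κ) (ν : Fin 3 → ℝ)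
    (a b c d : Fin 3 → ℝ) :
    ‖kuramotoField κ ν a - kuramotoField κ ν b - (kuramotoField κ ν c - kuramotoField κ ν d)‖ ≤
      2 * κ * (‖a - b - (c - d)‖ + ‖c - d‖ * (‖a - c‖ + ‖b - d‖)) := by
  refine (pi_norm_le_iff_of_nonneg (by positivity)).2 fun i => ?_
  have e : (kuramotoField κ ν a - kuramotoField κ ν b -
      (kuramotoField κ ν c - kuramotoField κ ν d)) i =
      κ / 3 * ∑ j, (Real.sin (a j - a i) - Real.sin (b j - b i) -
        (Real.sin (c j - c i) - Real.sin (d j - d i))) := by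
    simp only [kuramotoField, Pi.sub_apply, Finset.sum_sub_distrib]; ring
  rw [e, Real.norm_eq_abs]
  refine (abs_coupling_le hκ
    (C := 2 * (‖a - b - (c - d)‖ + ‖c - d‖ * (‖a - c‖ + ‖b - d‖))) fun j => ?_).trans_eq (by ring)
  refine (abs_sin_mixed_difference_le _ _ _ _).trans ?_
  have h1 := abs_coord_sub_le (a - b - (c - d)) i j
  have h2 := abs_coord_sub_le (c - d) i j
  have h3 := abs_coord_sub_le (a - c) i j
  have h4 := abs_coord_sub_le (b - d) i j
  simp only [Pi.sub_apply] at h1 h2 h3 h4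
  rw [show a j - a i - (b j - b i) - (c j - c i - (d j - d i)) =
      a j - b j - (c j - d j) - (a i - b i - (c i - d i)) by ring,
    show c j - c i - (d j - d i) = c j - d j - (c i - d i) by ring,
    show a j - a i - (c j - c i) = a j - c j - (a i - c i) by ring,
    show b j - b i - (d j - d i) = b j - d j - (b i - d i) by ring]
  have h5 := mul_le_mul h2 (add_le_add h3 h4) (by positivity) (by positivity)
  linarith

/-- The derivative of the Kuramoto vector field. -/
noncomputable def kuramotoFieldDeriv (κ : ℝ) (x : Fin 3 → ℝ) : (Fin 3 → ℝ) →L[ℝ] (Fin 3 → ℝ) :=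
  ContinuousLinearMap.pi fun i => (κ / 3) • ∑ j, Real.cos (x j - x i) •
    (ContinuousLinearMap.proj (R := ℝ) (φ := fun _ : Fin 3 => ℝ) j - ContinuousLinearMap.proj i)

theorem hasFDerivAt_kuramotoField (κ : ℝ) (ν x : Fin 3 → ℝ) :
    HasFDerivAt (kuramotoField κ ν) (kuramotoFieldDeriv κ x) x := by
  refine hasFDerivAt_pi.2 fun i => ?_
  refine ((HasFDerivAt.fun_sum fun j _ => ?_).const_mul (κ / 3)).const_add (ν i)
  exact (((hasFDerivAt_apply j x).sub (hasFDerivAt_apply i x))).sin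

theorem trace_kuramotoFieldDeriv (κ : ℝ) (x : Fin 3 → ℝ) :
    kuramotoFieldDeriv κ x (Pi.single 0 1) 0 + kuramotoFieldDeriv κ x (Pi.single 1 1) 1 +
      kuramotoFieldDeriv κ x (Pi.single 2 1) 2 = -(2 * κ / 3) * cosSum x := by
  have e10 : Real.cos (x 1 - x 0) = Real.cos (x 0 - x 1) := by rw [← Real.cos_neg, neg_sub]
  have e21 : Real.cos (x 2 - x 1) = Real.cos (x 1 - x 2) := by rw [← Real.cos_neg, neg_sub]
  have e02 : Real.cos (x 0 - x 2) = Real.cos (x 2 - x 0) := by rw [← Real.cos_neg, neg_sub]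
  simp [kuramotoFieldDeriv, cosSum, Fin.sum_univ_three, e10, e21, e02]
  ring

theorem abs_apply_single_le_norm (G : (Fin 3 → ℝ) →L[ℝ] (Fin 3 → ℝ)) (i j : Fin 3) :
    |G (Pi.single j 1) i| ≤ ‖G‖ := by
  have h1 : |G (Pi.single j 1) i| ≤ ‖G (Pi.single j 1)‖ := norm_le_pi_norm (G (Pi.single j 1)) i
  have h2 : ‖(Pi.single j 1 : Fin 3 → ℝ)‖ ≤ 1 := by
    refine (pi_norm_le_iff_of_nonneg zero_le_one).2 fun l => ?_
    by_cases hl : l = j <;> simp [hl]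
  exact h1.trans (G.unit_le_opNorm _ h2)

theorem le_det_id_add {L G : (Fin 3 → ℝ) →L[ℝ] (Fin 3 → ℝ)} {k : ℝ}
    (hG : L = ContinuousLinearMap.id ℝ _ + G) (hGk : ‖G‖ ≤ k) :
    1 + (G (Pi.single 0 1) 0 + G (Pi.single 1 1) 1 + G (Pi.single 2 1) 2) -
      6 * k ^ 2 - 6 * k ^ 3 ≤ L.det := by
  have hk : 0 ≤ k := (norm_nonneg _).trans hGk
  have hb : ∀ i j, |G (Pi.single j 1) i| ≤ k := fun i j =>
    (abs_apply_single_le_norm G i j).trans hGk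
  have hent : ∀ i j, LinearMap.toMatrix' (L : (Fin 3 → ℝ) →ₗ[ℝ] (Fin 3 → ℝ)) i j =
      (Pi.single j 1 : Fin 3 → ℝ) i + G (Pi.single j 1) i := fun i j => by
    rw [LinearMap.toMatrix'_apply, hG]
    simp
  have hdet : L.det =
      (LinearMap.toMatrix' (L : (Fin 3 → ℝ) →ₗ[ℝ] (Fin 3 → ℝ))).det := by
    rw [LinearMap.det_toMatrix']
  rw [hdet, Matrix.det_fin_three]
  simp only [hent]
  set b : Fin 3 → Fin 3 → ℝ := fun i j => G (Pi.single j 1) i with hbdef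
  have b2 : ∀ i j l m, |b i j * b l m| ≤ k ^ 2 := fun i j l m => by
    rw [abs_mul, sq]; exact mul_le_mul (hb _ _) (hb _ _) (abs_nonneg _) hk
  have b3 : ∀ i j l m p q, |b i j * b l m * b p q| ≤ k ^ 3 :=
    fun i j l m p q => by
      rw [abs_mul, pow_succ]; exact mul_le_mul (b2 _ _ _ _) (hb _ _) (abs_nonneg _) (by positivity)
  have q1 := abs_le.1 (b2 0 0 1 1)
  have q2 := abs_le.1 (b2 0 0 2 2)
  have q3 := abs_le.1 (b2 1 1 2 2)
  have q4 := abs_le.1 (b2 0 1 1 0)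
  have q5 := abs_le.1 (b2 0 2 2 0)
  have q6 := abs_le.1 (b2 1 2 2 1)
  have r1 := abs_le.1 (b3 0 0 1 1 2 2)
  have r2 := abs_le.1 (b3 0 0 1 2 2 1)
  have r3 := abs_le.1 (b3 0 1 1 0 2 2)
  have r4 := abs_le.1 (b3 0 1 1 2 2 0)
  have r5 := abs_le.1 (b3 0 2 1 0 2 1)
  have r6 := abs_le.1 (b3 0 2 1 1 2 0)
  simp only [hbdef] at q1 q2 q3 q4 q5 q6 r1 r2 r3 r4 r5 r6
  simp
  ring_nf at q1 q2 q3 q4 q5 q6 r1 r2 r3 r4 r5 r6 ⊢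
  linarith [q1.1, q2.1, q3.1, q4.2, q5.2, q6.2, r1.1, r2.2, r3.2, r4.1, r5.1, r6.2]

theorem lipschitzWith_kuramotoField {κ : ℝ} (hκ : 0 ≤ κ) (ν : Fin 3 → ℝ) :
    LipschitzWith (Real.toNNReal (2 * κ)) (kuramotoField κ ν) :=
  LipschitzWith.of_dist_le_mul fun x y => by
    rw [dist_eq_norm, dist_eq_norm, Real.coe_toNNReal _ (by positivity)]
    exact norm_kuramotoField_sub_le hκ ν x y

namespace IsKuramotoOn

variable {κ : ℝ} {ν : Fin 3 → ℝ} {θ η : ℝ → Fin 3 → ℝ}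

theorem hasDerivWithinAt_pi (h : IsKuramotoOn κ ν θ) {t : ℝ} (ht : 0 ≤ t) :
    HasDerivWithinAt θ (kuramotoField κ ν (θ t)) (Ici 0) t :=
  _root_.hasDerivWithinAt_pi.2 fun i => h.hasDerivWithinAt i ht

theorem continuousOn (h : IsKuramotoOn κ ν θ) : ContinuousOn θ (Ici 0) :=
  fun _ ht => (h.hasDerivWithinAt_pi ht).continuousWithinAt

theorem comp_add_const (h : IsKuramotoOn κ ν θ) {s : ℝ} (hs : 0 ≤ s) :
    IsKuramotoOn κ ν (fun t => θ (t + s)) := by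
  intro i t ht
  have ht' : 0 ≤ t + s := add_nonneg ht hs
  have h1 := h i (t + s) ht'
  have h2 : HasDerivWithinAt (fun u => u + s) 1 (Ici 0) t := (hasDerivWithinAt_id t _).add_const s
  exact (h1.scomp t h2 fun u hu => add_nonneg hu hs).congr_deriv (one_smul _ _)

theorem dist_le (hκ : 0 ≤ κ) (h : IsKuramotoOn κ ν θ) (h' : IsKuramotoOn κ ν η) {t : ℝ}
    (ht : 0 ≤ t) : dist (θ t) (η t) ≤ dist (θ 0) (η 0) * Real.exp (2 * κ * t) := by
  have key := dist_le_of_trajectories_ODE (v := fun _ => kuramotoField κ ν)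
    (fun _ => lipschitzWith_kuramotoField hκ ν)
    (h.continuousOn.mono Icc_subset_Ici_self)
    (fun s hs => (h.hasDerivWithinAt_pi hs.1).mono (Ici_subset_Ici.2 hs.1))
    (h'.continuousOn.mono Icc_subset_Ici_self)
    (fun s hs => (h'.hasDerivWithinAt_pi hs.1).mono (Ici_subset_Ici.2 hs.1))
    le_rfl t ⟨ht, le_rfl⟩
  rwa [Real.coe_toNNReal _ (by positivity), sub_zero] at key

theorem norm_sub_initial_le (hκ : 0 ≤ κ) (h : IsKuramotoOn κ ν θ) {t : ℝ} (ht : 0 ≤ t) :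
    ‖θ t - θ 0‖ ≤ (‖ν‖ + κ) * t := by
  have := norm_image_sub_le_of_norm_deriv_le_segment' (a := 0) (b := t)
    (fun s hs => (h.hasDerivWithinAt_pi hs.1).mono Icc_subset_Ici_self)
    (fun s _ => norm_kuramotoField_le hκ ν (θ s)) t ⟨ht, le_rfl⟩
  simpa using this

theorem norm_sub_sub_initial_le (hκ : 0 ≤ κ) (h : IsKuramotoOn κ ν θ) (h' : IsKuramotoOn κ ν η)
    {t : ℝ} (ht : 0 ≤ t) (ht1 : t ≤ 1) :
    ‖θ t - η t - (θ 0 - η 0)‖ ≤ 2 * κ * Real.exp (2 * κ) * ‖θ 0 - η 0‖ * t := by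
  have := norm_image_sub_le_of_norm_deriv_le_segment' (f := fun s => θ s - η s) (a := 0) (b := t)
    (C := 2 * κ * Real.exp (2 * κ) * ‖θ 0 - η 0‖)
    (fun s hs => ((h.hasDerivWithinAt_pi hs.1).sub (h'.hasDerivWithinAt_pi hs.1)).mono
      Icc_subset_Ici_self)
    (fun s hs => by
      refine (norm_kuramotoField_sub_le hκ ν _ _).trans ?_
      have h1 := h.dist_le hκ h' hs.1
      rw [dist_eq_norm, dist_eq_norm] at h1
      have h2 : Real.exp (2 * κ * s) ≤ Real.exp (2 * κ) :=
        Real.exp_le_exp.2 (mul_le_of_le_one_right (by positivity) (by linarith [hs.2]))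
      calc 2 * κ * ‖θ s - η s‖ ≤ 2 * κ * (‖θ 0 - η 0‖ * Real.exp (2 * κ)) := by
            gcongr
            exact h1.trans (by gcongr)
        _ = _ := by ring) t ⟨ht, le_rfl⟩
  simpa using this

/-- The Euler step approximates differences of solutions up to second order. -/
theorem norm_sub_euler_le (hκ : 0 ≤ κ) (h : IsKuramotoOn κ ν θ) (h' : IsKuramotoOn κ ν η)
    {t : ℝ} (ht : 0 ≤ t) (ht1 : t ≤ 1) :
    ‖θ t - η t - (θ 0 - η 0) - t • (kuramotoField κ ν (θ 0) - kuramotoField κ ν (η 0))‖ ≤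
      (4 * κ ^ 2 * Real.exp (2 * κ) + 4 * κ * (‖ν‖ + κ)) * t ^ 2 * ‖θ 0 - η 0‖ := by
  have := norm_image_sub_le_of_norm_deriv_le_segment'
    (f := fun s => θ s - η s - s • (kuramotoField κ ν (θ 0) - kuramotoField κ ν (η 0)))
    (f' := fun s => kuramotoField κ ν (θ s) - kuramotoField κ ν (η s) -
      (1 : ℝ) • (kuramotoField κ ν (θ 0) - kuramotoField κ ν (η 0))) (a := 0) (b := t)
    (C := (4 * κ ^ 2 * Real.exp (2 * κ) + 4 * κ * (‖ν‖ + κ)) * t * ‖θ 0 - η 0‖)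
    (fun s hs => (((h.hasDerivWithinAt_pi hs.1).sub (h'.hasDerivWithinAt_pi hs.1)).mono
      Icc_subset_Ici_self).sub ((hasDerivWithinAt_id s _).smul_const _))
    (fun s hs => by
      rw [one_smul]
      refine (norm_kuramotoField_mixed_difference_le hκ ν _ _ _ _).trans ?_
      have h1 := h.norm_sub_sub_initial_le hκ h' hs.1 (hs.2.le.trans ht1)
      have h2 := h.norm_sub_initial_le hκ hs.1
      have h3 := h'.norm_sub_initial_le hκ hs.1
      have hst := hs.2.le
      have hs0 := hs.1
      calc 2 * κ * (‖θ s - η s - (θ 0 - η 0)‖ + ‖θ 0 - η 0‖ * (‖θ s - θ 0‖ + ‖η s - η 0‖))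
          ≤ 2 * κ * (2 * κ * Real.exp (2 * κ) * ‖θ 0 - η 0‖ * s +
              ‖θ 0 - η 0‖ * ((‖ν‖ + κ) * s + (‖ν‖ + κ) * s)) := by gcongr
        _ = (4 * κ ^ 2 * Real.exp (2 * κ) + 4 * κ * (‖ν‖ + κ)) * s * ‖θ 0 - η 0‖ := by ring
        _ ≤ _ := by gcongr) t ⟨ht, le_rfl⟩
  simp only [zero_smul, sub_zero] at this
  rw [sub_right_comm]
  exact this.trans_eq (by ring)

end IsKuramotoOn

section Flow

variable {κ : ℝ} {ν : Fin 3 → ℝ} {Φ : (Fin 3 → ℝ) → ℝ → Fin 3 → ℝ}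

theorem kuramotoFlow_add (hκ : 0 ≤ κ) (hΦ0 : ∀ x, Φ x 0 = x) (hΦ : ∀ x, IsKuramotoOn κ ν (Φ x))
    (x : Fin 3 → ℝ) {s t : ℝ} (hs : 0 ≤ s) (ht : 0 ≤ t) : Φ (Φ x s) t = Φ x (t + s) := by
  have := (hΦ (Φ x s)).dist_le hκ ((hΦ x).comp_add_const hs) ht
  simp only [hΦ0, zero_add, dist_self, zero_mul] at this
  exact dist_le_zero.1 this

theorem lipschitzWith_kuramotoFlow (hκ : 0 ≤ κ) (hΦ0 : ∀ x, Φ x 0 = x)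
    (hΦ : ∀ x, IsKuramotoOn κ ν (Φ x)) {t : ℝ} (ht : 0 ≤ t) :
    LipschitzWith (Real.toNNReal (Real.exp (2 * κ * t))) (fun x => Φ x t) :=
  LipschitzWith.of_dist_le_mul fun x y => by
    have := (hΦ x).dist_le hκ (hΦ y) ht
    rw [hΦ0, hΦ0] at this
    rw [Real.coe_toNNReal _ (Real.exp_pos _).le]
    linarith

/-- For a short time `h`, the flow expands volume on the region where the divergence of the vector
field is bounded below. -/
theorem exists_kuramotoFlow_expanding (hκ : 0 < κ) (hΦ0 : ∀ x, Φ x 0 = x)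
    (hΦ : ∀ x, IsKuramotoOn κ ν (Φ x)) :
    ∃ h > 0, ∃ c > 1, ∀ B : Set (Fin 3 → ℝ), MeasurableSet B →
      (∀ x ∈ B, cosSum x ≤ -(1 / 10)) →
      ENNReal.ofReal c * volume B ≤ volume ((fun x => Φ x h) '' B) := by
  set C := 4 * κ ^ 2 * Real.exp (2 * κ) + 4 * κ * (‖ν‖ + κ) with hC
  have hC0 : 0 ≤ C := by positivity
  set K := 2 * κ + C with hK
  have hK0 : 0 < K := by positivity
  set Q := 3 * C + 6 * K ^ 2 + 6 * K ^ 3 with hQ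
  have hQ0 : 0 < Q := by positivity
  obtain ⟨h, hh0, hh1, hhK, hhQ⟩ : ∃ h > 0, h ≤ 1 ∧ K * h < 1 ∧ Q * h ≤ κ / 30 := by
    refine ⟨min 1 (min (1 / (2 * K)) (κ / 30 / Q)), by positivity, min_le_left _ _, ?_, ?_⟩
    · calc K * min 1 (min (1 / (2 * K)) (κ / 30 / Q)) ≤ K * (1 / (2 * K)) :=
            mul_le_mul_of_nonneg_left ((min_le_right _ _).trans (min_le_left _ _)) hK0.le
        _ < 1 := by field_simp; norm_num
    · calc Q * min 1 (min (1 / (2 * K)) (κ / 30 / Q)) ≤ Q * (κ / 30 / Q) :=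
            mul_le_mul_of_nonneg_left ((min_le_right _ _).trans (min_le_right _ _)) hQ0.le
        _ = κ / 30 := by field_simp
  have euler : ∀ x y, ‖Φ x h - Φ y h - (x - y) - h • (kuramotoField κ ν x - kuramotoField κ ν y)‖ ≤
      C * h ^ 2 * ‖x - y‖ := fun x y => by
    have := (hΦ x).norm_sub_euler_le hκ.le (hΦ y) hh0.le hh1
    rwa [hΦ0, hΦ0] at this
  have hh2 : h ^ 2 ≤ h := by nlinarith
  have near : ∀ x y, ‖Φ x h - Φ y h - (x - y)‖ ≤ K * h * ‖x - y‖ := fun x y => by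
    have h1 := euler x y
    have h2 := norm_kuramotoField_sub_le hκ.le ν x y
    have h3 := norm_le_norm_sub_add (Φ x h - Φ y h - (x - y))
      (h • (kuramotoField κ ν x - kuramotoField κ ν y))
    rw [norm_smul, Real.norm_eq_abs, abs_of_pos hh0] at h3
    have h4 := mul_le_mul_of_nonneg_left h2 hh0.le
    have h5 : C * h ^ 2 * ‖x - y‖ ≤ C * h * ‖x - y‖ := by gcongr
    rw [hK]
    linarith
  have inj : Function.Injective (fun x => Φ x h) := by
    intro x y hxy
    have h1 := near x y
    rw [show Φ x h = Φ y h from hxy, sub_self, zero_sub, norm_neg] at h1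
    by_contra hne
    have h2 : 0 < ‖x - y‖ := norm_pos_iff.2 (sub_ne_zero.2 hne)
    nlinarith
  refine ⟨h, hh0, 1 + h * (κ / 30), by simp only [gt_iff_lt]; nlinarith, fun B hB hBS => ?_⟩
  have det_ge : ∀ x ∈ B, DifferentiableAt ℝ (fun x => Φ x h) x →
      1 + h * (κ / 30) ≤ (fderiv ℝ (fun x => Φ x h) x).det := by
    intro x hx hd
    set L := fderiv ℝ (fun x => Φ x h) x with hL
    have hLd : HasFDerivAt (fun x => Φ x h) L x := hd.hasFDerivAt
    have g1 : ‖L - ContinuousLinearMap.id ℝ _‖ ≤ K * h := by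
      have := (hLd.sub (hasFDerivAt_id x)).le_of_lipschitz (C := Real.toNNReal (K * h))
        (LipschitzWith.of_dist_le_mul fun x y => by
          rw [dist_eq_norm, dist_eq_norm, Real.coe_toNNReal _ (by positivity)]
          refine le_trans (le_of_eq ?_) (near x y)
          congr 1
          simp only [Pi.sub_apply, id]
          abel)
      rwa [Real.coe_toNNReal _ (by positivity)] at this
    have g2 : ‖L - ContinuousLinearMap.id ℝ _ - h • kuramotoFieldDeriv κ x‖ ≤ C * h ^ 2 := by
      have := ((hLd.sub (hasFDerivAt_id x)).sub
        ((hasFDerivAt_kuramotoField κ ν x).const_smul h)).le_of_lipschitz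
        (C := Real.toNNReal (C * h ^ 2))
        (LipschitzWith.of_dist_le_mul fun x y => by
          rw [dist_eq_norm, dist_eq_norm, Real.coe_toNNReal _ (by positivity)]
          refine le_trans (le_of_eq ?_) (euler x y)
          congr 1
          simp only [Pi.sub_apply, Pi.smul_apply, id, smul_sub]
          abel)
      rwa [Real.coe_toNNReal _ (by positivity)] at this
    have hdet := le_det_id_add (L := L) (G := L - ContinuousLinearMap.id ℝ _) (by abel) g1
    have entry : ∀ i, h * kuramotoFieldDeriv κ x (Pi.single i 1) i - C * h ^ 2 ≤
        (L - ContinuousLinearMap.id ℝ (Fin 3 → ℝ)) (Pi.single i 1) i := by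
      intro i
      set R := L - ContinuousLinearMap.id ℝ _ - h • kuramotoFieldDeriv κ x with hR
      have h1 := (abs_le.1 ((abs_apply_single_le_norm R i i).trans g2)).1
      have h2 : R (Pi.single i 1) i =
          (L - ContinuousLinearMap.id ℝ (Fin 3 → ℝ)) (Pi.single i 1) i -
            h * kuramotoFieldDeriv κ x (Pi.single i 1) i := rfl
      linarith
    have tr := trace_kuramotoFieldDeriv κ x
    have t1 : κ / 15 ≤ -(2 * κ / 3) * cosSum x := by nlinarith [hBS x hx]
    rw [← tr] at t1
    have t2 := mul_le_mul_of_nonneg_left t1 hh0.le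
    have t3 := mul_le_mul_of_nonneg_left hhQ hh0.le
    have t4 : K ^ 3 * h ^ 3 ≤ K ^ 3 * h ^ 2 := by
      gcongr ?_ * ?_
      exact pow_le_pow_of_le_one hh0.le hh1 (by norm_num)
    rw [hQ] at t3
    linarith [entry 0, entry 1, entry 2]
  set D := B ∩ {x | DifferentiableAt ℝ (fun x => Φ x h) x} with hD
  have hDm : MeasurableSet D := hB.inter (measurableSet_of_differentiableAt ℝ _)
  have hDB : volume D = volume B :=
    measure_inter_conull (lipschitzWith_kuramotoFlow hκ.le hΦ0 hΦ hh0.le).ae_differentiableAt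
  calc ENNReal.ofReal (1 + h * (κ / 30)) * volume B
      = ∫⁻ _ in D, ENNReal.ofReal (1 + h * (κ / 30)) := by rw [setLIntegral_const, hDB]
    _ ≤ ∫⁻ x in D, ENNReal.ofReal |(fderiv ℝ (fun x => Φ x h) x).det| :=
      setLIntegral_mono' hDm fun x hx =>
        ENNReal.ofReal_le_ofReal ((det_ge x hx.1 hx.2).trans (le_abs_self _))
    _ = volume ((fun x => Φ x h) '' D) := lintegral_abs_det_fderiv_eq_addHaar_image volume hDm
      (fun x hx => hx.2.hasFDerivAt.hasFDerivWithinAt) inj.injOn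
    _ ≤ volume ((fun x => Φ x h) '' B) := measure_mono (image_mono inter_subset_left)

/-- Almost every solution reaches the region where the divergence may be negative. -/
theorem ae_exists_cosSum_gt (hκ : 0 < κ) (hΦ0 : ∀ x, Φ x 0 = x)
    (hΦ : ∀ x, IsKuramotoOn κ ν (Φ x)) :
    ∀ᵐ x, ∃ t ≥ 0, -(1 / 10) < cosSum (Φ x t) := by
  obtain ⟨h, hh, c, hc, hexp⟩ := exists_kuramotoFlow_expanding hκ hΦ0 hΦ
  set A : Set (Fin 3 → ℝ) := ⋂ t ∈ Ici (0 : ℝ), {x | cosSum (Φ x t) ≤ -(1 / 10)} with hA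
  have memA : ∀ x, x ∈ A ↔ ∀ t ≥ 0, cosSum (Φ x t) ≤ -(1 / 10) := fun x => by simp [hA]
  have contS : Continuous cosSum := by unfold cosSum; fun_prop
  have hAm : MeasurableSet A := (isClosed_biInter fun t ht =>
    isClosed_le (contS.comp (lipschitzWith_kuramotoFlow hκ.le hΦ0 hΦ ht).continuous)
      continuous_const).measurableSet
  have hnull : volume A = 0 := by
    refine volume_eq_zero_of_expanding (f := fun x => Φ x h) (M := (‖ν‖ + κ) * h) hc
      (by positivity) (fun x => ?_) (fun x hx => ?_) hAm
      (fun B hBA hB => hexp B hB fun x hx => ?_)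
    · have := (hΦ x).norm_sub_initial_le hκ.le hh.le
      rwa [hΦ0, ← dist_eq_norm] at this
    · rw [memA] at hx ⊢
      intro t ht
      rw [kuramotoFlow_add hκ.le hΦ0 hΦ x hh.le ht]
      exact hx _ (by positivity)
    · have := (memA x).1 (hBA hx) 0 le_rfl
      rwa [hΦ0] at this
  refine measure_mono_null (fun x hx => ?_) hnull
  rw [memA]
  intro t ht
  by_contra! hlt
  exact hx ⟨t, ht, hlt⟩

end Flow

/-- Corollary 3.3 (2): for `N = 3` and `κ > 4.8 D(Ω)`, for almost every initial
phase vector the flow phase-locks and is eventually confined, modulo 2π, to a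
quarter-circle. -/
theorem three_oscillators_ae_quarter_circle (κ : ℝ) (ν : Fin 3 → ℝ)
    (hκ : 4.8 * freqDiam ν < κ)
    (Φ : (Fin 3 → ℝ) → ℝ → Fin 3 → ℝ)
    (hΦ0 : ∀ Θ0 : Fin 3 → ℝ, Φ Θ0 0 = Θ0)
    (hΦ : ∀ Θ0 : Fin 3 → ℝ, IsKuramotoOn κ ν (Φ Θ0)) :
    ∀ᵐ Θ0 ∂(MeasureTheory.volume : MeasureTheory.Measure (Fin 3 → ℝ)),
      (∀ i j : Fin 3, ∃ L : ℝ,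
        Filter.Tendsto (fun t => Φ Θ0 t i - Φ Θ0 t j) Filter.atTop (nhds L)) ∧
      (∃ (m : Fin 3 → ℤ) (T : ℝ), 0 ≤ T ∧
        ∀ t ≥ T, ∀ i j : Fin 3,
          |(Φ Θ0 t i + 2 * Real.pi * m i) - (Φ Θ0 t j + 2 * Real.pi * m j)| ≤
            Real.pi / 2) := by
  have hν : ∀ i j, 4.8 * |ν i - ν j| < κ := fun i j =>
    (mul_le_mul_of_nonneg_left (abs_sub_le_freqDiam ν i j) (by norm_num)).trans_lt hκ
  have hκ0 : 0 < κ := by simpa using hν 0 0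
  filter_upwards [ae_exists_cosSum_gt hκ0 hΦ0 hΦ] with x ⟨t, ht, hS⟩
  exact (hΦ x).locked hν ht hS.le
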